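/- If G is a connected n-vertex graph with no induced 6-cycles and ι(G, P_3) ≠ (n+1)/4, then ι(G, P_3) ≤ ⌊n/4⌋. -/

import Mathlib

open SimpleGraph

/-- The closed neighbourhood `N[D]` of a set `D` of vertices in a graph `G`. -/
def closedNbhd {V : Type*} (G : SimpleGraph V) (D : Set V) : Set V :=
  D ∪ {v | ∃ d ∈ D, G.Adj d v}

/-- `G` contains a (not necessarily induced) copy of `H`. -/
def ContainsCopy {α β : Type*} (G : SimpleGraph α) (H : SimpleGraph β) : Prop :=
  ∃ f : β ↪ α, ∀ a b, H.Adj a b → G.Adj (f a) (f b)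

/-- `D` is a `P₃`-isolating set of `G`: `G − N[D]` contains no 3-vertex path. -/
def IsP3IsolatingSet {V : Type*} (G : SimpleGraph V) (D : Set V) : Prop :=
  ¬ ContainsCopy (SimpleGraph.induce (closedNbhd G D)ᶜ G) (SimpleGraph.pathGraph 3)

/-- The `P₃`-isolation number of `G`. -/
noncomputable def iotaP3 {V : Type*} (G : SimpleGraph V) : ℕ :=
  sInf {m | ∃ D : Set V, IsP3IsolatingSet G D ∧ D.ncard = m}

/-- `G` has an induced 6-cycle. -/
def HasInducedC6 {V : Type*} (G : SimpleGraph V) : Prop :=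
  ∃ f : Fin 6 ↪ V, ∀ a b, G.Adj (f a) (f b) ↔ (SimpleGraph.cycleGraph 6).Adj a b

namespace P3Iso

section

open scoped Classical

variable {V : Type*} (G : SimpleGraph V)

/-- `a` lies in the closed neighbourhood of `D`. -/
def Dom (D : Finset V) (a : V) : Prop := a ∈ D ∨ ∃ d ∈ D, G.Adj d a

/-- `D` isolates all 3-vertex paths inside `S`. -/
def Iso (S D : Finset V) : Prop :=
  ∀ a b c, a ∈ S → b ∈ S → c ∈ S → G.Adj a b → G.Adj b c → a ≠ c →
    Dom G D a ∨ Dom G D b ∨ Dom G D c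

/-- Connectedness of `G[S]`, in cut form. -/
def Cn (S : Finset V) : Prop :=
  S.Nonempty ∧ ∀ A, A ⊆ S → A.Nonempty → A ≠ S → ∃ a ∈ A, ∃ b ∈ S, b ∉ A ∧ G.Adj a b

/-- `P` is the set of components of `G[T]`. -/
structure Dec (T : Finset V) (P : Finset (Finset V)) : Prop where
  cn : ∀ K ∈ P, Cn G K
  cov : ∀ a ∈ T, ∃ K ∈ P, a ∈ K
  sub : ∀ K ∈ P, K ⊆ T
  sep : ∀ K ∈ P, ∀ K' ∈ P, ∀ a ∈ K, ∀ b ∈ K', (a = b ∨ G.Adj a b) → K = K'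

/-- The isolation number of `G[S]` exceeds `|S|/4`. -/
def Bad (S : Finset V) : Prop := ¬ ∃ D, Iso G S D ∧ 4 * D.card ≤ S.card

def AA (S : Finset V) : Prop := ∃ D, Iso G S D ∧ 4 * D.card ≤ S.card + 1

def PP (S : Finset V) : Prop :=
  Bad G S → ∀ Y, Y.Nonempty → ∀ R, (∀ a ∈ R, a ∈ S ∧ a ∉ Y) → Y ⊆ S →
    ∃ D, Iso G R D ∧ 4 * D.card + 3 ≤ S.card

variable {G}

theorem Dom.mono {D D' : Finset V} (h : D ⊆ D') {a : V} (ha : Dom G D a) : Dom G D' a := by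
  rcases ha with ha | ⟨d, hd, ha⟩
  · exact Or.inl (h ha)
  · exact Or.inr ⟨d, h hd, ha⟩

theorem Iso.mono {S S' D D' : Finset V} (hS : S' ⊆ S) (hD : D ⊆ D') (h : Iso G S D) :
    Iso G S' D' := by
  intro a b c ha hb hc hab hbc hac
  rcases h a b c (hS ha) (hS hb) (hS hc) hab hbc hac with h | h | h
  · exact Or.inl (h.mono hD)
  · exact Or.inr (Or.inl (h.mono hD))
  · exact Or.inr (Or.inr (h.mono hD))

theorem dec_union {A B : Finset V} {P Q : Finset (Finset V)} (hP : Dec G A P) (hQ : Dec G B Q)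
    (hd : ∀ a ∈ A, ∀ b ∈ B, a ≠ b ∧ ¬ G.Adj a b) : Dec G (A ∪ B) (P ∪ Q) := by
  classical
  refine ⟨?_, ?_, ?_, ?_⟩
  · intro K hK
    rcases Finset.mem_union.1 hK with h | h
    · exact hP.cn K h
    · exact hQ.cn K h
  · intro a ha
    rcases Finset.mem_union.1 ha with h | h
    · obtain ⟨K, hK, h⟩ := hP.cov a h
      exact ⟨K, Finset.mem_union_left _ hK, h⟩
    · obtain ⟨K, hK, h⟩ := hQ.cov a h
      exact ⟨K, Finset.mem_union_right _ hK, h⟩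
  · intro K hK
    rcases Finset.mem_union.1 hK with h | h
    · exact (hP.sub K h).trans Finset.subset_union_left
    · exact (hQ.sub K h).trans Finset.subset_union_right
  · intro K hK K' hK' a ha b hb hab
    rcases Finset.mem_union.1 hK with h | h <;> rcases Finset.mem_union.1 hK' with h' | h'
    · exact hP.sep K h K' h' a ha b hb hab
    · have := hd a (hP.sub K h ha) b (hQ.sub K' h' hb)
      tauto
    · have := hd b (hP.sub K' h' hb) a (hQ.sub K h ha)
      rcases hab with hab | hab
      · exact absurd hab.symm this.1
      · exact absurd hab.symm this.2
    · exact hQ.sep K h K' h' a ha b hb hab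

theorem dec_single {K : Finset V} (hK : Cn G K) : Dec G K {K} := by
  refine ⟨?_, ?_, ?_, ?_⟩ <;> simp <;> assumption

theorem exists_dec (T : Finset V) : ∃ P, Dec G T P := by
  classical
  induction T using Finset.strongInduction with
  | H T ih =>
    rcases T.eq_empty_or_nonempty with rfl | hne
    · exact ⟨∅, by refine ⟨?_, ?_, ?_, ?_⟩ <;> simp⟩
    by_cases hc : Cn G T
    · exact ⟨_, dec_single hc⟩
    · have : ∃ A, A ⊆ T ∧ A.Nonempty ∧ A ≠ T ∧ ∀ a ∈ A, ∀ b ∈ T, b ∉ A → ¬ G.Adj a b := by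
        by_contra hcon
        push Not at hcon
        refine hc ⟨hne, fun A h1 h2 h3 => ?_⟩
        exact hcon A h1 h2 h3
      obtain ⟨A, hA, hAn, hAT, hno⟩ := this
      obtain ⟨P, hP⟩ := ih A (Finset.ssubset_iff_subset_ne.2 ⟨hA, hAT⟩)
      obtain ⟨Q, hQ⟩ := ih (T \ A) (Finset.sdiff_ssubset hA hAn)
      refine ⟨P ∪ Q, ?_⟩
      have := dec_union hP hQ (fun a ha b hb => by
        rw [Finset.mem_sdiff] at hb
        exact ⟨fun h => hb.2 (h ▸ ha), hno a ha b hb.1 hb.2⟩)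
      rwa [Finset.union_sdiff_of_subset hA] at this

theorem dec_card {T : Finset V} {P : Finset (Finset V)} (hP : Dec G T P) :
    ∑ K ∈ P, K.card = T.card := by
  classical
  have : T = P.biUnion id := by
    ext a
    simp only [Finset.mem_biUnion, id]
    exact ⟨fun h => hP.cov a h, fun ⟨K, hK, h⟩ => hP.sub K hK h⟩
  rw [this, Finset.card_biUnion]
  · rfl
  · intro K hK K' hK' hne
    refine Finset.disjoint_left.2 ?_
    intro a ha ha'
    exact hne (hP.sep K hK K' hK' a ha a ha' (Or.inl rfl))

theorem combine {S T D0 : Finset V} {P : Finset (Finset V)} (hP : Dec G T P)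
    (hU : ∀ a ∈ S, a ∈ T ∨ Dom G D0 a) (f : Finset V → Finset V)
    (hf : ∀ K ∈ P, Iso G (K.filter fun a => ¬ Dom G D0 a) (f K)) :
    Iso G S (D0 ∪ P.biUnion f) := by
  intro a b c ha hb hc hab hbc hac
  by_contra hcon
  push Not at hcon
  obtain ⟨na, nb, nc⟩ := hcon
  have key : ∀ x, ¬ Dom G (D0 ∪ P.biUnion f) x → ¬ Dom G D0 x :=
    fun x hx h => hx (h.mono Finset.subset_union_left)
  have hTa := (hU a ha).resolve_right (key a na)
  have hTb := (hU b hb).resolve_right (key b nb)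
  have hTc := (hU c hc).resolve_right (key c nc)
  obtain ⟨K, hK, haK⟩ := hP.cov a hTa
  obtain ⟨K', hK', hbK⟩ := hP.cov b hTb
  obtain ⟨K'', hK'', hcK⟩ := hP.cov c hTc
  obtain rfl := hP.sep K hK K' hK' a haK b hbK (Or.inr hab)
  obtain rfl := hP.sep K hK K'' hK'' b hbK c hcK (Or.inr hbc)
  have hsub : f K ⊆ D0 ∪ P.biUnion f :=
    (Finset.subset_biUnion_of_mem f hK).trans Finset.subset_union_right
  rcases hf K hK a b c (by simp [haK, key a na]) (by simp [hbK, key b nb])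
    (by simp [hcK, key c nc]) hab hbc hac with h | h | h
  · exact na (h.mono hsub)
  · exact nb (h.mono hsub)
  · exact nc (h.mono hsub)

theorem combineA {S T D0 : Finset V} {P : Finset (Finset V)} (hP : Dec G T P)
    (hU : ∀ a ∈ S, a ∈ T ∨ Dom G D0 a) (hA : ∀ K ∈ P, AA G K) :
    ∃ D, Iso G S D ∧ 4 * D.card ≤ 4 * D0.card + T.card + (P.filter (Bad G)).card := by
  have : ∀ K, ∃ D, K ∈ P → Iso G K D ∧ 4 * D.card ≤ K.card + if Bad G K then 1 else 0 := by
    intro K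
    by_cases hK : K ∈ P
    · by_cases hb : Bad G K
      · obtain ⟨D, h1, h2⟩ := hA K hK
        exact ⟨D, fun _ => ⟨h1, by simpa [hb] using h2⟩⟩
      · have hb' := hb
        unfold Bad at hb'
        push Not at hb'
        obtain ⟨D, h1, h2⟩ := hb'
        exact ⟨D, fun _ => ⟨h1, by simpa [hb] using h2⟩⟩
    · exact ⟨∅, fun h => absurd h hK⟩
  choose f hf using this
  refine ⟨_, combine hP hU f (fun K hK => (hf K hK).1.mono (Finset.filter_subset _ _) le_rfl), ?_⟩
  have h1 : (D0 ∪ P.biUnion f).card ≤ D0.card + ∑ K ∈ P, (f K).card :=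
    (Finset.card_union_le _ _).trans (Nat.add_le_add_left Finset.card_biUnion_le _)
  have h2 : ∑ K ∈ P, 4 * (f K).card ≤ ∑ K ∈ P, (K.card + if Bad G K then 1 else 0) :=
    Finset.sum_le_sum fun K hK => (hf K hK).2
  have h3 : ∑ K ∈ P, (if Bad G K then 1 else 0) = (P.filter (Bad G)).card := by
    rw [Finset.card_filter]
  rw [← Finset.mul_sum, Finset.sum_add_distrib, dec_card hP, h3] at h2
  omega

theorem combineB {S T D0 : Finset V} {P : Finset (Finset V)} (hP : Dec G T P)
    (hU : ∀ a ∈ S, a ∈ T ∨ Dom G D0 a) (hA : ∀ K ∈ P, PP G K)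
    (hm : ∀ K ∈ P, Bad G K → ∃ a ∈ K, Dom G D0 a) :
    ∃ D, Iso G S D ∧ 4 * D.card + 3 * (P.filter (Bad G)).card ≤ 4 * D0.card + T.card := by
  have : ∀ K, ∃ D, K ∈ P → Iso G (K.filter fun a => ¬ Dom G D0 a) D ∧
      4 * D.card + (if Bad G K then 3 else 0) ≤ K.card := by
    intro K
    by_cases hK : K ∈ P
    · by_cases hb : Bad G K
      · obtain ⟨a, ha, had⟩ := hm K hK hb
        obtain ⟨D, h1, h2⟩ := hA K hK hb (K.filter fun a => Dom G D0 a) ⟨a, by simp [ha, had]⟩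
          (K.filter fun a => ¬ Dom G D0 a)
          (by intro a ha; simp only [Finset.mem_filter] at ha ⊢; tauto) (Finset.filter_subset _ _)
        exact ⟨D, fun _ => ⟨h1, by simpa [hb] using h2⟩⟩
      · have hb' := hb
        unfold Bad at hb'
        push Not at hb'
        obtain ⟨D, h1, h2⟩ := hb'
        exact ⟨D, fun _ => ⟨h1.mono (Finset.filter_subset _ _) le_rfl, by simpa [hb] using h2⟩⟩
    · exact ⟨∅, fun h => absurd h hK⟩
  choose f hf using this
  refine ⟨_, combine hP hU f (fun K hK => (hf K hK).1), ?_⟩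
  have h1 : (D0 ∪ P.biUnion f).card ≤ D0.card + ∑ K ∈ P, (f K).card :=
    (Finset.card_union_le _ _).trans (Nat.add_le_add_left Finset.card_biUnion_le _)
  have h2 : ∑ K ∈ P, (4 * (f K).card + if Bad G K then 3 else 0) ≤ ∑ K ∈ P, K.card :=
    Finset.sum_le_sum fun K hK => (hf K hK).2
  have h3 : ∑ K ∈ P, (if Bad G K then 3 else 0) = 3 * (P.filter (Bad G)).card := by
    rw [Finset.card_filter, Finset.mul_sum]
    exact Finset.sum_congr rfl fun K _ => by split_ifs <;> rfl
  rw [Finset.sum_add_distrib, ← Finset.mul_sum, dec_card hP, h3] at h2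
  omega

/-- Every component of `S \ Y` has a neighbour in `Y`. -/
theorem attach {S T : Finset V} {P : Finset (Finset V)} (hS : Cn G S) (hP : Dec G T P)
    (hT : T ⊆ S) (hne : T ≠ S) {K : Finset V} (hK : K ∈ P) :
    ∃ a ∈ K, ∃ y ∈ S, y ∉ T ∧ G.Adj a y := by
  have hKS : K ⊆ S := (hP.sub K hK).trans hT
  obtain ⟨a, ha, b, hb, hbK, hab⟩ := hS.2 K hKS (hP.cn K hK).1 (by
    rintro rfl
    exact hne (hT.antisymm (hP.sub K hK)))
  refine ⟨a, ha, b, hb, fun hbT => ?_, hab⟩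
  obtain ⟨K', hK', hbK'⟩ := hP.cov b hbT
  obtain rfl := hP.sep K hK K' hK' a ha b hbK' (Or.inr hab)
  exact hbK hbK'

theorem lemQ {S Y : Finset V} {P : Finset (Finset V)} (hS : Cn G S) (hP : Dec G (S \ Y) P)
    (hY : Y.Nonempty) (hYS : Y ⊆ S) (hA : ∀ K ∈ P, PP G K) :
    ∃ D, Iso G S D ∧ 4 * D.card + 3 * (P.filter (Bad G)).card ≤ S.card + 3 * Y.card := by
  obtain ⟨D, h1, h2⟩ := combineB (S := S) (D0 := Y) hP (by
      intro a ha
      by_cases h : a ∈ Y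
      · exact Or.inr (Or.inl h)
      · exact Or.inl (Finset.mem_sdiff.2 ⟨ha, h⟩)) hA (by
      intro K hK _
      obtain ⟨a, ha, y, hy, hyT, hay⟩ := attach hS hP Finset.sdiff_subset
        (Finset.sdiff_ssubset hYS hY).ne hK
      refine ⟨a, ha, Or.inr ⟨y, ?_, hay.symm⟩⟩
      by_contra h
      exact hyT (Finset.mem_sdiff.2 ⟨hy, h⟩))
  refine ⟨D, h1, ?_⟩
  rw [Finset.card_sdiff_of_subset hYS] at h2
  have := Finset.card_le_card hYS
  omega

theorem pp_of {S : Finset V} (hS : Cn G S) (hA : AA G S)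
    (ih : ∀ K, Cn G K → K ⊂ S → AA G K ∧ PP G K) : PP G S := by
  classical
  intro hb Y hY R hR hYS
  obtain ⟨D, hD, hDc⟩ := hA
  have hlt : ¬ 4 * D.card ≤ S.card := fun h => hb ⟨D, hD, h⟩
  obtain ⟨P, hP⟩ := exists_dec (G := G) (S \ Y)
  have hss : ∀ K ∈ P, K ⊂ S := fun K hK =>
    lt_of_le_of_lt (hP.sub K hK) (Finset.sdiff_ssubset hYS hY)
  obtain ⟨E, hE, hEc⟩ := lemQ hS hP hY hYS (fun K hK => (ih K (hP.cn K hK) (hss K hK)).2)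
  have hE' : ¬ 4 * E.card ≤ S.card := fun h => hb ⟨E, hE, h⟩
  obtain ⟨F, hF, hFc⟩ := combineA (S := R) (D0 := ∅) hP
    (fun a ha => Or.inl (Finset.mem_sdiff.2 (hR a ha)))
    (fun K hK => (ih K (hP.cn K hK) (hss K hK)).1)
  refine ⟨F, hF, ?_⟩
  rw [Finset.card_sdiff_of_subset hYS] at hFc
  have := Finset.card_le_card hYS
  simp only [Finset.card_empty] at hFc
  omega

/-- Bad component adjacent to a single vertex. -/
theorem case_single {S K : Finset V} {x : V} (hS : Cn G S)
    (ih : ∀ K, Cn G K → K ⊂ S → AA G K ∧ PP G K) (hK : Cn G K) (hKS : K ⊆ S) (hx : x ∈ S)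
    (hxK : x ∉ K) (hb : Bad G K) (hno : ∀ a ∈ K, ∀ b ∈ S, G.Adj a b → b ∈ K ∨ b = x) : AA G S := by
  classical
  obtain ⟨Q, hQ⟩ := exists_dec (G := G) ((S \ {x}) \ K)
  have hP : Dec G (S \ {x}) ({K} ∪ Q) := by
    have := dec_union (dec_single hK) hQ (by
      intro a ha b hb'
      simp only [Finset.mem_sdiff, Finset.mem_singleton] at hb'
      refine ⟨fun h => hb'.2 (h ▸ ha), fun h => ?_⟩
      have := hno a ha b hb'.1.1 h
      tauto)
    have hsub : K ⊆ S \ {x} := by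
      intro a ha
      simp only [Finset.mem_sdiff, Finset.mem_singleton]
      exact ⟨hKS ha, fun h => hxK (h ▸ ha)⟩
    rwa [Finset.union_sdiff_of_subset hsub] at this
  have hxs : ({x} : Finset V) ⊆ S := by simpa using hx
  obtain ⟨D, hD, hDc⟩ := lemQ hS hP ⟨x, by simp⟩ hxs (fun K' hK' =>
    (ih K' (hP.cn K' hK') (lt_of_le_of_lt (hP.sub K' hK')
      (Finset.sdiff_ssubset hxs ⟨x, by simp⟩))).2)
  refine ⟨D, hD, ?_⟩
  have : 0 < (({K} ∪ Q).filter (Bad G)).card :=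
    Finset.card_pos.2 ⟨K, by simp [hb]⟩
  simp only [Finset.card_singleton] at hDc
  omega

/-- Choice of the covering set. -/
theorem choose_cover {α : Type*} (N : Finset V) (B : Finset α)
    (r : α → V → Prop)
    (h2 : ∀ K ∈ B, ∃ x ∈ N, ∃ y ∈ N, x ≠ y ∧ r K x ∧ r K y) (hN : 2 ≤ N.card)
    (hB : N.card ≤ B.card + 1) (hlast : ¬ (N.card = 2 ∧ B.card = 1)) :
    ∃ X : Finset V, X ⊆ N ∧ (∀ K ∈ B, ∃ x ∈ X, r K x) ∧ 4 * X.card + 2 ≤ N.card + 3 * B.card := by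
  classical
  by_cases hb : N.card ≤ B.card
  · obtain ⟨z, hz⟩ : N.Nonempty := Finset.card_pos.1 (by omega)
    refine ⟨N.erase z, Finset.erase_subset _ _, ?_, ?_⟩
    · intro K hK
      obtain ⟨x, hx, y, hy, hxy, h1, h2⟩ := h2 K hK
      by_cases h : x = z
      · exact ⟨y, Finset.mem_erase.2 ⟨fun h' => hxy (h.trans h'.symm), hy⟩, h2⟩
      · exact ⟨x, Finset.mem_erase.2 ⟨h, hx⟩, h1⟩
    · rw [Finset.card_erase_of_mem hz]
      omega
  · have hcard : N.card = B.card + 1 := by omega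
    -- pigeonhole by double counting
    have hex : ∃ x ∈ N, 1 < (B.filter fun K => r K x).card := by
      by_contra hcon
      push Not at hcon
      have e1 : ∑ K ∈ B, (N.filter fun x => r K x).card = ∑ x ∈ N, (B.filter fun K => r K x).card :=
        Finset.sum_card_bipartiteAbove_eq_sum_card_bipartiteBelow r
      have e2 : ∑ x ∈ N, (B.filter fun K => r K x).card ≤ ∑ x ∈ N, 1 :=
        Finset.sum_le_sum hcon
      have e3 : ∑ K ∈ B, 2 ≤ ∑ K ∈ B, (N.filter fun x => r K x).card := by
        refine Finset.sum_le_sum fun K hK => ?_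
        obtain ⟨x, hx, y, hy, hxy, h1, h2⟩ := h2 K hK
        exact Finset.one_lt_card.2 ⟨x, by simp [hx, h1], y, by simp [hy, h2], hxy⟩
      simp only [Finset.sum_const, smul_eq_mul] at e2 e3
      omega
    obtain ⟨x, hx, hx2⟩ := hex
    have : ∀ K, ∃ y, K ∈ B → y ∈ N ∧ r K y := by
      intro K
      by_cases hK : K ∈ B
      · obtain ⟨x, hx, y, hy, hxy, h1, h2⟩ := h2 K hK
        exact ⟨x, fun _ => ⟨hx, h1⟩⟩
      · exact ⟨x, fun h => absurd h hK⟩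
    choose g hg using this
    refine ⟨insert x ((B.filter fun K => ¬ r K x).image g), ?_, ?_, ?_⟩
    · intro y hy
      rcases Finset.mem_insert.1 hy with rfl | hy
      · exact hx
      · obtain ⟨K, hK, rfl⟩ := Finset.mem_image.1 hy
        exact (hg K (Finset.mem_filter.1 hK).1).1
    · intro K hK
      by_cases h : r K x
      · exact ⟨x, Finset.mem_insert_self _ _, h⟩
      · exact ⟨g K, Finset.mem_insert_of_mem (Finset.mem_image_of_mem g (by simp [hK, h])),
          (hg K hK).2⟩
    · have c1 := Finset.card_insert_le x ((B.filter fun K => ¬ r K x).image g)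
      have c2 : ((B.filter fun K => ¬ r K x).image g).card ≤ _ := Finset.card_image_le
      have c3 := Finset.card_filter_add_card_filter_not (s := B) (fun K => r K x)
      omega

theorem hasC6 {a b c d e f : V} (h1 : G.Adj a b) (h2 : G.Adj b c) (h3 : G.Adj c d)
    (h4 : G.Adj d e) (h5 : G.Adj e f) (h6 : G.Adj f a) (n1 : ¬ G.Adj a c) (n2 : ¬ G.Adj a d)
    (n3 : ¬ G.Adj a e) (n4 : ¬ G.Adj b d) (n5 : ¬ G.Adj b e) (n6 : ¬ G.Adj b f)
    (n7 : ¬ G.Adj c e) (n8 : ¬ G.Adj c f) (n9 : ¬ G.Adj d f)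
    (e1 : a ≠ c) (e2 : a ≠ d) (e3 : a ≠ e) (e4 : b ≠ d) (e5 : b ≠ e) (e6 : b ≠ f)
    (e7 : c ≠ e) (e8 : c ≠ f) (e9 : d ≠ f) : HasInducedC6 G := by
  have q1 := h1.ne
  have q2 := h2.ne
  have q3 := h3.ne
  have q4 := h4.ne
  have q5 := h5.ne
  have q6 := h6.ne
  refine ⟨⟨![a, b, c, d, e, f], ?_⟩, ?_⟩
  · intro i j hij
    fin_cases i <;> fin_cases j <;> first | rfl | (exfalso; simp at hij; grind)
  · intro i j
    have key : ∀ i j : Fin 6, i < j → (G.Adj (![a, b, c, d, e, f] i) (![a, b, c, d, e, f] j) ↔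
        (SimpleGraph.cycleGraph 6).Adj i j) := by
      intro i j hij
      fin_cases i <;> fin_cases j <;> first
        | (exfalso; revert hij; decide)
        | (refine iff_of_true ?_ (by decide); first | assumption | exact h6.symm)
        | (refine iff_of_false ?_ (by decide); assumption)
    rcases lt_trichotomy i j with h | rfl | h
    · exact key i j h
    · exact iff_of_false (G.irrefl) ((SimpleGraph.cycleGraph 6).irrefl)
    · have := key j i h
      rw [G.adj_comm, (SimpleGraph.cycleGraph 6).adj_comm] at this
      exact this

theorem case_cycle {S H : Finset V} {v x1 x2 y1 y2 : V} (hS : Cn G S) (h6 : ¬ HasInducedC6 G)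
    (hdeg : ∀ a ∈ S, ∀ p ∈ S, ∀ q ∈ S, G.Adj a p → G.Adj a q → p ≠ q →
      ∀ r ∈ S, G.Adj a r → r = p ∨ r = q)
    (ih : ∀ K, Cn G K → K ⊂ S → AA G K) (hH : Cn G H) (hHS : H ⊆ S)
    (hv : v ∈ S) (hx1 : x1 ∈ S) (hx2 : x2 ∈ S) (h12 : x1 ≠ x2)
    (hvx1 : G.Adj v x1) (hvx2 : G.Adj v x2) (hvH : v ∉ H) (hx1H : x1 ∉ H) (hx2H : x2 ∉ H)
    (hy1 : y1 ∈ H) (hy2 : y2 ∈ H) (hxy1 : G.Adj x1 y1) (hxy2 : G.Adj x2 y2)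
    (hmod : H.card % 4 = 3)
    (hcl : ∀ a ∈ H, ∀ b ∈ S, G.Adj a b → b ∈ H ∨ b = x1 ∨ b = x2) : AA G S := by
  have ne : ∀ {a b}, a ∈ H → b ∉ H → a ≠ b := fun ha hb h => hb (h ▸ ha)
  have hvx1n : v ≠ x1 := hvx1.ne
  have hvx2n : v ≠ x2 := hvx2.ne
  have nv := hdeg v hv x1 hx1 x2 hx2 hvx1 hvx2 h12
  have nx1 := hdeg x1 hx1 v hv y1 (hHS hy1) hvx1.symm hxy1 (ne hy1 hvH).symm
  have nx2 := hdeg x2 hx2 v hv y2 (hHS hy2) hvx2.symm hxy2 (ne hy2 hvH).symm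
  have hSall : ∀ a ∈ S, a = v ∨ a = x1 ∨ a = x2 ∨ a ∈ H := by
    by_contra hcon
    push Not at hcon
    obtain ⟨q, hq, hq1, hq2, hq3, hq4⟩ := hcon
    obtain ⟨a, ha, b, hb, hbA, hab⟩ := hS.2 (insert v (insert x1 (insert x2 H)))
      (by intro a ha; simp only [Finset.mem_insert] at ha
          rcases ha with rfl | rfl | rfl | ha <;> first | assumption | exact hHS ha)
      ⟨v, by simp⟩ (by
        intro h
        rw [← h] at hq
        simp only [Finset.mem_insert] at hq
        tauto)
    simp only [Finset.mem_insert, not_or] at ha hbA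
    obtain ⟨b1, b2, b3, b4⟩ := hbA
    rcases ha with rfl | rfl | rfl | ha
    · rcases nv b hb hab with h | h <;> contradiction
    · rcases nx1 b hb hab with rfl | rfl <;> contradiction
    · rcases nx2 b hb hab with rfl | rfl <;> contradiction
    · rcases hcl a ha b hb hab with h | h | h <;> contradiction
  -- follow the path
  obtain ⟨z, hz, hzy, hyz⟩ : ∃ z ∈ H, z ≠ y1 ∧ G.Adj y1 z := by
    obtain ⟨a, ha, b, hb, hbA, hab⟩ := hH.2 {y1} (by simpa using hy1) ⟨y1, by simp⟩ (by
      rintro rfl; simp at hmod)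
    simp only [Finset.mem_singleton] at ha hbA
    subst ha
    exact ⟨b, hb, hbA, hab⟩
  have ny1 := hdeg y1 (hHS hy1) x1 hx1 z (hHS hz) hxy1.symm hyz (ne hz hx1H).symm
  have hyy : y1 ≠ y2 := by
    rintro rfl
    rcases ny1 x2 hx2 hxy2.symm with h | h
    · exact h12 h.symm
    · exact hx2H (h ▸ hz)
  obtain ⟨w, hw, hwy, hwz, hzw⟩ : ∃ w ∈ H, w ≠ y1 ∧ w ≠ z ∧ G.Adj z w := by
    obtain ⟨a, ha, b, hb, hbA, hab⟩ := hH.2 {y1, z}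
      (by intro a; simp only [Finset.mem_insert, Finset.mem_singleton]; rintro (rfl | rfl) <;> assumption)
      ⟨y1, by simp⟩ (by
        intro h
        have := Finset.card_le_two (a := y1) (b := z)
        rw [h] at this; omega)
    simp only [Finset.mem_insert, Finset.mem_singleton, not_or] at ha hbA
    rcases ha with rfl | rfl
    · rcases ny1 b (hHS hb) hab with h | h
      · exact absurd h (ne hb hx1H)
      · exact absurd h hbA.2
    · exact ⟨b, hb, hbA.1, hbA.2, hab⟩
  have nz := hdeg z (hHS hz) y1 (hHS hy1) w (hHS hw) hyz.symm hzw hwy.symm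
  have hzy2 : z ≠ y2 := by
    rintro rfl
    rcases nz x2 hx2 hxy2.symm with h | h
    · exact hx2H (h ▸ hy1)
    · exact hx2H (h ▸ hw)
  have sub3 : ({y1, z, w} : Finset V) ⊆ H := by
    intro a; simp only [Finset.mem_insert, Finset.mem_singleton]
    rintro (rfl | rfl | rfl) <;> assumption
  have card3 : ({y1, z, w} : Finset V).card = 3 :=
    Finset.card_eq_three.2 ⟨y1, z, w, hzy.symm, hwy.symm, hwz.symm, rfl⟩
  by_cases hH3 : H.card = 3
  · exfalso
    have hHe : ({y1, z, w} : Finset V) = H := Finset.eq_of_subset_of_card_le sub3 (by omega)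
    have hy2w : y2 = w := by
      rw [← hHe] at hy2
      simp only [Finset.mem_insert, Finset.mem_singleton] at hy2
      rcases hy2 with h | h | h
      · exact absurd h.symm hyy
      · exact absurd h.symm hzy2
      · exact h
    subst hy2w
    have nw := hdeg y2 (hHS hy2) z (hHS hz) x2 hx2 hzw.symm hxy2.symm (ne hz hx2H)
    have sv := hv
    have sy1 := hHS hy1
    have sz := hHS hz
    have sw := hHS hy2
    have n1 : ¬ G.Adj v y1 := fun h => by
      rcases nv _ sy1 h with h | h
      · exact ne hy1 hx1H h
      · exact ne hy1 hx2H h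
    have n2 : ¬ G.Adj v z := fun h => by
      rcases nv _ sz h with h | h
      · exact ne hz hx1H h
      · exact ne hz hx2H h
    have n3 : ¬ G.Adj v y2 := fun h => by
      rcases nv _ sw h with h | h
      · exact ne hy2 hx1H h
      · exact ne hy2 hx2H h
    have n4 : ¬ G.Adj x1 z := fun h => by
      rcases nx1 _ sz h with h | h
      · exact ne hz hvH h
      · exact hzy h
    have n5 : ¬ G.Adj x1 y2 := fun h => by
      rcases nx1 _ sw h with h | h
      · exact ne hy2 hvH h
      · exact hyy h.symm
    have n6 : ¬ G.Adj x1 x2 := fun h => by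
      rcases nx1 _ hx2 h with h | h
      · exact hvx2n h.symm
      · exact ne hy1 hx2H h.symm
    have n7 : ¬ G.Adj y1 y2 := fun h => by
      rcases ny1 _ sw h with h | h
      · exact ne hy2 hx1H h
      · exact hwz h
    have n8 : ¬ G.Adj y1 x2 := fun h => by
      rcases ny1 _ hx2 h with h | h
      · exact h12 h.symm
      · exact ne hz hx2H h.symm
    have n9 : ¬ G.Adj z x2 := fun h => by
      rcases nz _ hx2 h with h | h
      · exact ne hy1 hx2H h.symm
      · exact ne hy2 hx2H h.symm
    have d1 := ne hy1 hvH
    have d2 := ne hz hvH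
    have d3 := ne hy2 hvH
    have d4 := ne hy1 hx1H
    have d5 := ne hz hx1H
    have d6 := ne hy2 hx1H
    have d7 := ne hy1 hx2H
    have d8 := ne hz hx2H
    have d9 := ne hy2 hx2H
    exact h6 (hasC6 hvx1 hxy1 hyz hzw hxy2.symm hvx2.symm n1 n2 n3 n4 n5 n6 n7 n8 n9
      d1.symm d2.symm d3.symm d5.symm d6.symm h12 hyy d7 d8)
  · have hH7 : 7 ≤ H.card := by omega
    obtain ⟨u, hu, huy, huz, huw, hwu⟩ : ∃ u ∈ H, u ≠ y1 ∧ u ≠ z ∧ u ≠ w ∧ G.Adj w u := by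
      obtain ⟨a, ha, b, hb, hbA, hab⟩ := hH.2 {y1, z, w} sub3 ⟨y1, by simp⟩ (by
          intro h
          rw [h] at card3; omega)
      simp only [Finset.mem_insert, Finset.mem_singleton, not_or] at ha hbA
      obtain ⟨b1, b2, b3⟩ := hbA
      rcases ha with rfl | rfl | rfl
      · rcases ny1 b (hHS hb) hab with h | h
        · exact absurd h (ne hb hx1H)
        · exact absurd h b2
      · rcases nz b (hHS hb) hab with h | h <;> contradiction
      · exact ⟨b, hb, b1, b2, b3, hab⟩
    have nw := hdeg w (hHS hw) z (hHS hz) u (hHS hu) hzw.symm hwu huz.symm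
    obtain ⟨t, ht, hty, htz, htw, htu, hut⟩ :
        ∃ t ∈ H, t ≠ y1 ∧ t ≠ z ∧ t ≠ w ∧ t ≠ u ∧ G.Adj u t := by
      obtain ⟨a, ha, b, hb, hbA, hab⟩ := hH.2 {y1, z, w, u}
        (by intro a; simp only [Finset.mem_insert, Finset.mem_singleton]
            rintro (rfl | rfl | rfl | rfl) <;> assumption) ⟨y1, by simp⟩ (by
          intro h
          have := Finset.card_le_four (a := y1) (b := z) (c := w) (d := u)
          rw [h] at this; omega)
      simp only [Finset.mem_insert, Finset.mem_singleton, not_or] at ha hbA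
      obtain ⟨b1, b2, b3, b4⟩ := hbA
      rcases ha with rfl | rfl | rfl | rfl
      · rcases ny1 b (hHS hb) hab with h | h
        · exact absurd h (ne hb hx1H)
        · exact absurd h b2
      · rcases nz b (hHS hb) hab with h | h <;> contradiction
      · rcases nw b (hHS hb) hab with h | h <;> contradiction
      · exact ⟨b, hb, b1, b2, b3, b4, hab⟩
    have nu := hdeg u (hHS hu) w (hHS hw) t (hHS ht) hwu.symm hut htw.symm
    set F : Finset V := {y1, z, w, u, t} with hF
    have hFH : F ⊆ H := by
      intro a; simp only [hF, Finset.mem_insert, Finset.mem_singleton]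
      rintro (rfl | rfl | rfl | rfl | rfl) <;> assumption
    have hFc : F.card = 5 := by
      rw [hF, Finset.card_insert_of_notMem, Finset.card_insert_of_notMem,
        Finset.card_insert_of_notMem, Finset.card_pair htu.symm] <;>
        simp only [Finset.mem_insert, Finset.mem_singleton, not_or] <;>
        simp [hzy.symm, hwy.symm, huy.symm, hty.symm, hwz.symm, huz.symm, htz.symm, huw.symm,
          htw.symm]
    have hRc : (H \ F).card + 5 = H.card := by
      rw [← hFc]; exact Finset.card_sdiff_add_card_eq_card hFH
    have memR : ∀ a, a ∈ H \ F ↔ a ∈ H ∧ a ≠ y1 ∧ a ≠ z ∧ a ≠ w ∧ a ≠ u ∧ a ≠ t := by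
      intro a; simp [hF]
    -- only `t` has neighbours in the remainder
    have onlyt : ∀ a ∈ H \ F, ∀ b ∈ F, G.Adj a b → b = t := by
      intro a ha b hb hab
      rw [memR] at ha
      obtain ⟨a0, a1, a2, a3, a4, a5⟩ := ha
      simp only [hF, Finset.mem_insert, Finset.mem_singleton] at hb
      rcases hb with rfl | rfl | rfl | rfl | rfl
      · rcases ny1 a (hHS a0) hab.symm with h | h
        · exact absurd h (ne a0 hx1H)
        · contradiction
      · rcases nz a (hHS a0) hab.symm with h | h <;> contradiction
      · rcases nw a (hHS a0) hab.symm with h | h <;> contradiction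
      · rcases nu a (hHS a0) hab.symm with h | h <;> contradiction
      · rfl
    have closedR : ∀ B ⊆ H \ F, B.Nonempty → (∀ a ∈ B, ¬ G.Adj a t) →
        ∃ a ∈ B, ∃ b ∈ H \ F, b ∉ B ∧ G.Adj a b := by
      intro B hB hBn hBt
      obtain ⟨a, ha, b, hb, hbB, hab⟩ := hH.2 B (hB.trans Finset.sdiff_subset) hBn (by
        rintro rfl
        have := hB hy1
        rw [memR] at this
        exact this.2.1 rfl)
      refine ⟨a, ha, b, ?_, hbB, hab⟩
      by_contra hbR
      have hbF : b ∈ F := by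
        by_contra h
        exact hbR (Finset.mem_sdiff.2 ⟨hb, h⟩)
      have := onlyt a (hB ha) b hbF hab
      subst this
      exact hBt a ha hab
    have hAR : AA G (H \ F) := by
      rcases (H \ F).eq_empty_or_nonempty with he | hne
      · rw [he]
        exact ⟨∅, by intro a b c ha; simp at ha, by simp⟩
      · refine ih _ ⟨hne, ?_⟩ ?_
        · intro A hA hAn hAne
          by_cases hAt : ∀ a ∈ A, ¬ G.Adj a t
          · exact closedR A hA hAn hAt
          · push Not at hAt
            obtain ⟨r, hr, hrt⟩ := hAt
            obtain ⟨a, ha, b, hb, hbB, hab⟩ := closedR ((H \ F) \ A) Finset.sdiff_subset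
              (Finset.sdiff_nonempty.2 fun h => hAne (hA.antisymm h)) (by
                intro a ha hat
                rw [Finset.mem_sdiff] at ha
                have hr' := (memR r).1 (hA hr)
                have ha' := (memR a).1 ha.1
                rcases hdeg t (hHS ht) u (hHS hu) r (hHS hr'.1) hut.symm hrt.symm
                  hr'.2.2.2.2.1.symm a (hHS ha'.1) hat.symm with h | h
                · exact ha'.2.2.2.2.1 h
                · exact ha.2 (h ▸ hr))
            rw [Finset.mem_sdiff] at ha
            refine ⟨b, ?_, a, ha.1, ha.2, hab.symm⟩
            by_contra h
            exact hbB (Finset.mem_sdiff.2 ⟨hb, h⟩)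
        · refine Finset.ssubset_iff_subset_ne.2 ⟨Finset.sdiff_subset.trans hHS, ?_⟩
          intro h
          rw [← h] at hv
          exact hvH (Finset.sdiff_subset hv)
    obtain ⟨D, hD, hDc⟩ := hAR
    refine ⟨{v, u} ∪ D, ?_, ?_⟩
    · have hdom : ∀ a ∈ S, ¬ Dom G ({v, u} ∪ D) a → a = y1 ∨ a = z ∨ a ∈ H \ F := by
        intro a ha hnd
        have k1 : ∀ d, d = v ∨ d = u → d ≠ a ∧ ¬ G.Adj d a := by
          intro d hd
          have hm : d ∈ ({v, u} ∪ D : Finset V) := by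
            simp only [Finset.mem_union, Finset.mem_insert, Finset.mem_singleton]
            exact Or.inl hd
          exact ⟨fun h => hnd (Or.inl (h ▸ hm)), fun h => hnd (Or.inr ⟨d, hm, h⟩)⟩
        have kv := k1 v (Or.inl rfl)
        have ku := k1 u (Or.inr rfl)
        rcases hSall a ha with rfl | rfl | rfl | haH
        · exact absurd rfl kv.1
        · exact absurd hvx1 kv.2
        · exact absurd hvx2 kv.2
        · rw [memR]
          by_cases e1 : a = y1
          · exact Or.inl e1
          by_cases e2 : a = z
          · exact Or.inr (Or.inl e2)
          refine Or.inr (Or.inr ⟨haH, e1, e2, ?_, ?_, ?_⟩)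
          · rintro rfl; exact ku.2 hwu.symm
          · rintro rfl; exact ku.1 rfl
          · rintro rfl; exact ku.2 hut
      intro a b c ha hb hc hab hbc hac
      by_contra hcon
      push Not at hcon
      obtain ⟨na, nb, nc⟩ := hcon
      have hy1F : y1 ∈ F := by simp [hF]
      have hzF : z ∈ F := by simp [hF]
      have hR : b ∈ H \ F → ∀ p, p ∈ S → ¬ Dom G ({v, u} ∪ D) p → G.Adj b p → p ∈ H \ F := by
        intro hbR p hp hpd hbp
        rcases hdom p hp hpd with rfl | rfl | h
        · exact absurd (onlyt b hbR _ hy1F hbp) hty.symm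
        · exact absurd (onlyt b hbR _ hzF hbp) htz.symm
        · exact h
      have hyz' : ∀ p, p ∈ S → ¬ Dom G ({v, u} ∪ D) p → (b = y1 → G.Adj b p → p = z) ∧
          (b = z → G.Adj b p → p = y1) := by
        intro p hp hpd
        constructor
        · rintro rfl hbp
          rcases ny1 p hp hbp with rfl | h
          · rcases hdom _ hp hpd with h | h | h
            · exact absurd h.symm (ne hy1 hx1H)
            · exact h
            · exact absurd (Finset.sdiff_subset h) hx1H
          · exact h
        · rintro rfl hbp
          rcases nz p hp hbp with h | rfl
          · exact h
          · rcases hdom _ hp hpd with h | h | h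
            · exact h
            · exact absurd h hwz
            · exact absurd rfl ((memR _).1 h).2.2.2.1
      rcases hdom b hb nb with h | h | h
      · exact hac (((hyz' a ha na).1 h hab.symm).trans ((hyz' c hc nc).1 h hbc).symm)
      · exact hac (((hyz' a ha na).2 h hab.symm).trans ((hyz' c hc nc).2 h hbc).symm)
      · rcases hD a b c (hR h a ha na hab.symm) h (hR h c hc nc hbc) hab hbc hac with h | h | h
        · exact na (h.mono Finset.subset_union_right)
        · exact nb (h.mono Finset.subset_union_right)
        · exact nc (h.mono Finset.subset_union_right)
    · have c1 : ({v, u} ∪ D : Finset V).card ≤ 2 + D.card :=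
        (Finset.card_union_le _ _).trans (Nat.add_le_add_right Finset.card_le_two _)
      have c2 : H.card + 3 ≤ S.card := by
        have : (insert v (insert x1 (insert x2 H))).card = H.card + 3 := by
          rw [Finset.card_insert_of_notMem, Finset.card_insert_of_notMem,
            Finset.card_insert_of_notMem hx2H] <;> simp [*]
        rw [← this]
        apply Finset.card_le_card
        intro a ha; simp only [Finset.mem_insert] at ha
        rcases ha with rfl | rfl | rfl | ha <;> first | assumption | exact hHS ha
      omega

theorem aa_of {S : Finset V} (h6 : ¬ HasInducedC6 G) (hS : Cn G S)
    (ih : ∀ K, Cn G K → K ⊂ S → AA G K ∧ PP G K) : AA G S := by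
  by_cases hsmall : ∀ v ∈ S, (S.filter (G.Adj v)).card ≤ 1
  · refine ⟨∅, ?_, by simp⟩
    intro a b c ha hb hc hab hbc hac
    have := Finset.card_le_one.1 (hsmall b hb) a (by simp [ha, hab.symm]) c (by simp [hc, hbc])
    exact absurd this hac
  -- choose `v` of degree at least 2, and at least 3 if possible
  have hv : ∃ v ∈ S, 2 ≤ (S.filter (G.Adj v)).card ∧ ((S.filter (G.Adj v)).card = 2 →
      ∀ a ∈ S, (S.filter (G.Adj a)).card ≤ 2) := by
    by_cases h3 : ∀ a ∈ S, (S.filter (G.Adj a)).card ≤ 2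
    · push Not at hsmall
      obtain ⟨v, hv, h⟩ := hsmall
      exact ⟨v, hv, h, fun _ => h3⟩
    · push Not at h3
      obtain ⟨v, hv, h⟩ := h3
      exact ⟨v, hv, by omega, fun h' => by omega⟩
  obtain ⟨v, hv, hd2, hdeg⟩ := hv
  set N := S.filter (G.Adj v) with hN
  set T := S \ insert v N with hT
  have hvN : v ∉ N := by simp [hN]
  have hNS : N ⊆ S := Finset.filter_subset _ _
  have hins : insert v N ⊆ S := Finset.insert_subset hv hNS
  have hTc : T.card + N.card + 1 = S.card := by
    have := Finset.card_sdiff_add_card_eq_card hins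
    rw [Finset.card_insert_of_notMem hvN] at this
    omega
  have hTS : T ⊆ S := Finset.sdiff_subset
  have hTlt : T ⊂ S := Finset.sdiff_ssubset hins ⟨v, by simp⟩
  obtain ⟨P, hP⟩ := exists_dec (G := G) T
  have hss : ∀ K ∈ P, K ⊂ S := fun K hK => lt_of_le_of_lt (hP.sub K hK) hTlt
  have hcov : ∀ D0 : Finset V, v ∈ D0 → ∀ a ∈ S, a ∈ T ∨ Dom G D0 a := by
    intro D0 hD0 a ha
    by_cases h : a ∈ insert v N
    · rcases Finset.mem_insert.1 h with rfl | h
      · exact Or.inr (Or.inl hD0)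
      · exact Or.inr (Or.inr ⟨v, hD0, (Finset.mem_filter.1 h).2⟩)
    · exact Or.inl (Finset.mem_sdiff.2 ⟨ha, h⟩)
  have hadjT : ∀ a ∈ T, ∀ b ∈ S, b ∉ T → G.Adj a b → b ∈ N := by
    intro a ha b hb hbT hab
    rw [hT, Finset.mem_sdiff] at ha hbT
    have : b ∈ insert v N := by
      by_contra h
      exact hbT ⟨hb, h⟩
    rcases Finset.mem_insert.1 this with rfl | h
    · exact absurd (Finset.mem_insert_of_mem (Finset.mem_filter.2 ⟨ha.1, hab.symm⟩)) ha.2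
    · exact h
  set B := P.filter (Bad G) with hB
  by_cases hb : B.card + 2 ≤ N.card
  · obtain ⟨D, hD, hDc⟩ := combineA (S := S) (D0 := {v}) hP (hcov _ (by simp))
      (fun K hK => (ih K (hP.cn K hK) (hss K hK)).1)
    refine ⟨D, hD, ?_⟩
    rw [Finset.card_singleton, ← hB] at hDc
    omega
  -- neighbours of a component
  have hout : ∀ K ∈ P, ∀ a ∈ K, ∀ b ∈ S, G.Adj a b → b ∈ K ∨ b ∈ N := by
    intro K hK a ha b hb' hab
    by_cases hbT : b ∈ T
    · obtain ⟨K', hK', hbK'⟩ := hP.cov b hbT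
      obtain rfl := hP.sep K hK K' hK' a ha b hbK' (Or.inr hab)
      exact Or.inl hbK'
    · exact Or.inr (hadjT a (hP.sub K hK ha) b hb' hbT hab)
  have hNT : ∀ x ∈ N, x ∉ T := by
    intro x hx hxT
    rw [hT, Finset.mem_sdiff] at hxT
    exact hxT.2 (Finset.mem_insert_of_mem hx)
  by_cases hone : ∀ K ∈ B, ∃ x ∈ N, ∃ y ∈ N, x ≠ y ∧ (∃ a ∈ K, G.Adj x a) ∧ (∃ a ∈ K, G.Adj y a)
  swap
  · push Not at hone
    obtain ⟨K, hKB, hK2⟩ := hone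
    obtain ⟨hK, hbad⟩ := Finset.mem_filter.1 hKB
    obtain ⟨a, ha, x, hx, hxT, hax⟩ := attach hS hP hTS hTlt.ne hK
    have hxN := hadjT a (hP.sub K hK ha) x hx hxT hax
    refine case_single (x := x) hS ih (hP.cn K hK) (hss K hK).1 hx
      (fun h => hxT (hP.sub K hK h)) hbad ?_
    intro p hp q hq hpq
    rcases hout K hK p hp q hq hpq with h | h
    · exact Or.inl h
    · right
      by_contra hne
      exact hK2 x hxN q h (Ne.symm hne) ⟨a, ha, hax.symm⟩ p hp hpq.symm
  by_cases hlast : N.card = 2 ∧ B.card = 1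
  · obtain ⟨H, hBH⟩ := Finset.card_eq_one.1 hlast.2
    have hHB : H ∈ B := by rw [hBH]; simp
    obtain ⟨hH, hbad⟩ := Finset.mem_filter.1 hHB
    obtain ⟨x1, hx1, x2, hx2, h12, ⟨y1, hy1, hxy1⟩, ⟨y2, hy2, hxy2⟩⟩ := hone H hHB
    have hNe : ∀ x ∈ N, x = x1 ∨ x = x2 := by
      intro x hx
      by_contra h
      push Not at h
      have : 2 < N.card := Finset.two_lt_card.2 ⟨x, hx, x1, hx1, x2, hx2, h.1, h.2, h12⟩
      omega
    refine case_cycle (v := v) hS h6 ?_ (fun K h1 h2 => (ih K h1 h2).1) (hP.cn H hH) (hss H hH).1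
      hv (hNS hx1) (hNS hx2) h12 (Finset.mem_filter.1 hx1).2 (Finset.mem_filter.1 hx2).2 ?_
      (fun h => hNT _ hx1 (hP.sub H hH h)) (fun h => hNT _ hx2 (hP.sub H hH h)) hy1 hy2 hxy1 hxy2
      ?_ ?_
    · intro a ha p hp q hq hap haq hpq r hr har
      by_contra h
      push Not at h
      have : 2 < (S.filter (G.Adj a)).card := Finset.two_lt_card.2
        ⟨r, by simp [hr, har], p, by simp [hp, hap], q, by simp [hq, haq], h.1, h.2, hpq⟩
      have := hdeg hlast.1 a ha
      omega
    · intro h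
      have := hP.sub H hH h
      rw [hT, Finset.mem_sdiff] at this
      exact this.2 (Finset.mem_insert_self _ _)
    · obtain ⟨D, hD, hDc⟩ := (ih H (hP.cn H hH) (hss H hH)).1
      have : ¬ 4 * D.card ≤ H.card := fun h => hbad ⟨D, hD, h⟩
      omega
    · intro a ha b hb' hab
      rcases hout H hH a ha b hb' hab with h | h
      · exact Or.inl h
      · exact Or.inr (hNe b h)
  obtain ⟨X, hXN, hX, hXc⟩ := choose_cover N B (fun K x => ∃ a ∈ K, G.Adj x a) hone hd2 (by omega)
    hlast
  obtain ⟨D, hD, hDc⟩ := combineB (S := S) (D0 := insert v X) hP (hcov _ (by simp))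
    (fun K hK => (ih K (hP.cn K hK) (hss K hK)).2) (by
      intro K hK hbad
      obtain ⟨x, hx, a, ha, hxa⟩ := hX K (Finset.mem_filter.2 ⟨hK, hbad⟩)
      exact ⟨a, ha, Or.inr ⟨x, Finset.mem_insert_of_mem hx, hxa⟩⟩)
  refine ⟨D, hD, ?_⟩
  have := Finset.card_insert_le v X
  rw [← hB] at hDc
  omega

theorem main (h6 : ¬ HasInducedC6 G) (S : Finset V) : Cn G S → AA G S ∧ PP G S := by
  induction S using Finset.strongInduction with
  | H S ih =>
    intro hS
    have ih' : ∀ K, Cn G K → K ⊂ S → AA G K ∧ PP G K := fun K h1 h2 => ih K h2 h1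
    have hA := aa_of h6 hS ih'
    exact ⟨hA, pp_of hS hA ih'⟩

end

end P3Iso

theorem stmt_14 {V : Type*} [Fintype V] (G : SimpleGraph V)
    (hc : G.Connected) (h6 : ¬ HasInducedC6 G)
    (hne : 4 * iotaP3 G ≠ Fintype.card V + 1) :
    iotaP3 G ≤ Fintype.card V / 4 := by
  classical
  have hcn : P3Iso.Cn G Finset.univ := by
    refine ⟨?_, ?_⟩
    · obtain ⟨v⟩ := hc.nonempty
      exact ⟨v, Finset.mem_univ v⟩
    · intro A _ hA hne'
      obtain ⟨a, ha⟩ := hA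
      obtain ⟨b, hb⟩ : ∃ b, b ∉ A := by
        by_contra h
        push Not at h
        exact hne' (Finset.eq_univ_iff_forall.2 h)
      obtain ⟨p⟩ := hc.preconnected a b
      obtain ⟨d, -, h1, h2⟩ := p.exists_boundary_dart (A : Set V) (by simpa using ha)
        (by simpa using hb)
      exact ⟨d.fst, by simpa using h1, d.snd, Finset.mem_univ _, by simpa using h2, d.adj⟩
  obtain ⟨D, hD, hDc⟩ := (P3Iso.main h6 Finset.univ hcn).1
  have hle : iotaP3 G ≤ D.card := by
    refine Nat.sInf_le ⟨(D : Set V), ?_, Set.ncard_coe_finset D⟩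
    rintro ⟨f, hf⟩
    have h01 := hf 0 1 (by simp [SimpleGraph.pathGraph_adj])
    have h12 := hf 1 2 (by simp [SimpleGraph.pathGraph_adj])
    have key : ∀ i, ¬ P3Iso.Dom G D (f i).1 := by
      intro i h
      apply (f i).2
      rcases h with h | ⟨d, hd, h⟩
      · exact Or.inl (by simpa using h)
      · exact Or.inr ⟨d, by simpa using hd, h⟩
    rcases hD (f 0) (f 1) (f 2) (Finset.mem_univ _) (Finset.mem_univ _) (Finset.mem_univ _)
      (by simpa using h01) (by simpa using h12) (by
        intro h
        have := f.injective (Subtype.ext h)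
        exact absurd this (by decide)) with h | h | h
    · exact key 0 h
    · exact key 1 h
    · exact key 2 h
  rw [Finset.card_univ] at hDc
  omega
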